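/- For every integer n ≥ 1, the Laurent series (−1)ⁿ · (X·ψ_n(X,Y)² − ψ_{n+1}(X,Y)·ψ_{n−1}(X,Y)) · (2ψ_n(X,Y)/ψ_{2n}(X,Y)) · t^{−n²} lies in 1 + tK[[t]]; in particular its Laurent expansion has leading term t⁰ with coefficient 1. (This is the statement that the w-coordinate of the map β_nˢ in Definition of the isogeny system is regular and invertible at the point at infinity, with value 1 there.) -/

import Mathlib

open HahnSeries

/-- `f = c·t^d + O(t^(d+1))`, where the coefficient `c` is allowed to vanish. -/
def HasLeadingTerm {K : Type*} [Field K] (f : LaurentSeries K) (d : ℤ) (c : K) : Prop :=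
  ∃ h : PowerSeries K, PowerSeries.constantCoeff h = c ∧
    f = HahnSeries.single d (1 : K) * (h : LaurentSeries K)

namespace HasLeadingTerm

variable {K : Type*} [Field K] {f g : LaurentSeries K} {d e : ℤ} {c c' : K}

theorem congr (hf : HasLeadingTerm f d c) (hd : d = e) (hc : c = c') : HasLeadingTerm f e c' :=
  hd ▸ hc ▸ hf

theorem const (a : K) : HasLeadingTerm (HahnSeries.C a : LaurentSeries K) 0 a :=
  ⟨PowerSeries.C a, by simp, by simp⟩

theorem natCast (n : ℕ) : HasLeadingTerm (n : LaurentSeries K) 0 (n : K) := by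
  simpa using const (n : K)

theorem zero (d : ℤ) : HasLeadingTerm (0 : LaurentSeries K) d 0 :=
  ⟨0, by simp, by simp⟩

theorem mul (hf : HasLeadingTerm f d c) (hg : HasLeadingTerm g e c') :
    HasLeadingTerm (f * g) (d + e) (c * c') := by
  obtain ⟨u, rfl, rfl⟩ := hf
  obtain ⟨v, rfl, rfl⟩ := hg
  refine ⟨u * v, by simp, ?_⟩
  have h : HahnSeries.single (d + e) (1 : K)
      = HahnSeries.single d (1 : K) * HahnSeries.single e (1 : K) := by simp
  rw [h, PowerSeries.coe_mul]
  ring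

theorem pow (hf : HasLeadingTerm f d c) (n : ℕ) : HasLeadingTerm (f ^ n) (n * d) (c ^ n) := by
  induction n with
  | zero => simpa using natCast (K := K) 1
  | succ n ih =>
    rw [pow_succ]
    exact (ih.mul hf).congr (by push_cast; ring) (by ring)

theorem add (hf : HasLeadingTerm f d c) (hg : HasLeadingTerm g d c') :
    HasLeadingTerm (f + g) d (c + c') := by
  obtain ⟨u, rfl, rfl⟩ := hf
  obtain ⟨v, rfl, rfl⟩ := hg
  exact ⟨u + v, by simp, by rw [PowerSeries.coe_add, mul_add]⟩

theorem sub (hf : HasLeadingTerm f d c) (hg : HasLeadingTerm g d c') :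
    HasLeadingTerm (f - g) d (c - c') := by
  obtain ⟨u, rfl, rfl⟩ := hf
  obtain ⟨v, rfl, rfl⟩ := hg
  exact ⟨u - v, by simp, by rw [PowerSeries.coe_sub, mul_sub]⟩

theorem of_lt (hf : HasLeadingTerm f e c) (h : d < e) : HasLeadingTerm f d 0 := by
  obtain ⟨u, rfl, rfl⟩ := hf
  obtain ⟨k, hk⟩ := Int.eq_ofNat_of_zero_le (sub_nonneg.2 h.le)
  have hk0 : k ≠ 0 := by omega
  refine ⟨PowerSeries.X ^ k * u, by simp [hk0], ?_⟩
  rw [PowerSeries.coe_mul, PowerSeries.coe_pow, PowerSeries.coe_X, HahnSeries.single_pow,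
    ← mul_assoc, HahnSeries.single_mul_single]
  congr 3
  · rw [nsmul_one]
    lia
  · simp

theorem inv (hf : HasLeadingTerm f d c) (hc : c ≠ 0) : HasLeadingTerm f⁻¹ (-d) c⁻¹ := by
  obtain ⟨u, rfl, rfl⟩ := hf
  refine ⟨u⁻¹, by simp, ?_⟩
  apply inv_eq_of_mul_eq_one_right
  have h : HahnSeries.single d (1 : K) * HahnSeries.single (-d) (1 : K) = 1 := by simp
  rw [mul_mul_mul_comm, h, ← PowerSeries.coe_mul, PowerSeries.mul_inv_cancel u hc]
  simp

theorem div (hf : HasLeadingTerm f d c) (hg : HasLeadingTerm g e c') (hc : c' ≠ 0) :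
    HasLeadingTerm (f / g) (d - e) (c / c') := by
  rw [div_eq_mul_inv]
  exact (hf.mul (hg.inv hc)).congr (by ring) (by ring)

/-- A Laurent series with constant leading term `c` is of the form `c + t·K⟦t⟧`. -/
theorem exists_eq_add (hf : HasLeadingTerm f 0 c) :
    ∃ u : PowerSeries K, f = HahnSeries.C c + HahnSeries.single 1 1 * (u : LaurentSeries K) := by
  obtain ⟨h, rfl, rfl⟩ := hf
  refine ⟨PowerSeries.mk fun p => PowerSeries.coeff (p + 1) h, ?_⟩
  conv_lhs => rw [PowerSeries.eq_X_mul_shift_add_const h]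
  rw [PowerSeries.coe_add, PowerSeries.coe_mul, PowerSeries.coe_X, PowerSeries.coe_C, add_comm]
  simp

/-- If `t^k·f` lies in `c + t·K⟦t⟧`, then `f` has leading term `c·t^(-k)`. -/
theorem of_single_pow_mul {k : ℕ} {u : PowerSeries K}
    (h : HahnSeries.single (1 : ℤ) (1 : K) ^ k * f
      = HahnSeries.C c + HahnSeries.single 1 1 * (u : LaurentSeries K)) :
    HasLeadingTerm f (-k) c := by
  refine ⟨PowerSeries.C c + PowerSeries.X * u, by simp, ?_⟩
  rw [PowerSeries.coe_add, PowerSeries.coe_mul, PowerSeries.coe_X, PowerSeries.coe_C, ← h,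
    ← mul_assoc, HahnSeries.single_pow, HahnSeries.single_mul_single]
  simp

end HasLeadingTerm

open HasLeadingTerm in
/-- A sequence satisfying the recurrences of the division polynomials has leading terms
`(-1)^(n+1)·n·t^(1-n²)` as soon as its terms with index `2`, `3`, `4` do. -/
theorem hasLeadingTerm_of_divisionRecurrence {K : Type*} [Field K] [CharZero K]
    (ψ : ℕ → LaurentSeries K) (hψ₀ : ψ 0 = 0) (hψ₁ : ψ 1 = 1)
    (h₂ : HasLeadingTerm (ψ 2) (-3) (-2)) (h₃ : HasLeadingTerm (ψ 3) (-8) 3)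
    (h₄ : HasLeadingTerm (ψ 4) (-15) (-4))
    (hψodd : ∀ m : ℕ, 2 ≤ m →
        ψ (2 * m + 1) = ψ (m + 2) * ψ m ^ 3 - ψ (m - 1) * ψ (m + 1) ^ 3)
    (hψeven : ∀ m : ℕ, 2 ≤ m →
        ψ 2 * ψ (2 * m) = ψ m * (ψ (m + 2) * ψ (m - 1) ^ 2 - ψ (m - 2) * ψ (m + 1) ^ 2))
    (n : ℕ) : HasLeadingTerm (ψ n) (1 - (n : ℤ) ^ 2) ((-1) ^ (n + 1) * n) := by
  induction n using Nat.strong_induction_on with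
  | _ n ih =>
  by_cases hn : n < 5
  · interval_cases n
    · rw [hψ₀]
      exact (zero 1).congr (by simp) (by simp)
    · rw [hψ₁]
      simpa using natCast (K := K) 1
    · exact h₂.congr (by norm_num) (by norm_num)
    · exact h₃.congr (by norm_num) (by norm_num)
    · exact h₄.congr (by norm_num) (by norm_num)
  have sign (k : ℕ) : ((-1 : K) ^ k) ^ 2 = 1 := by rw [← pow_mul, mul_comm, pow_mul]; simp
  obtain ⟨m, rfl | rfl⟩ := Nat.even_or_odd' n
  · obtain ⟨k, rfl⟩ : ∃ k, m = k + 2 := ⟨m - 2, by omega⟩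
    have h := hψeven (k + 2) (by omega)
    simp only [show k + 2 - 1 = k + 1 by omega, show k + 2 - 2 = k by omega] at h
    have hψ2 : ψ 2 ≠ 0 := by
      intro h0
      obtain ⟨u, hu, hu'⟩ := h₂
      rw [h0, eq_comm, mul_eq_zero] at hu'
      rcases hu' with hu' | hu'
      · simp at hu'
      · rw [(map_eq_zero_iff _ HahnSeries.ofPowerSeries_injective).1 hu'] at hu
        simp at hu
    have key := (((ih (k + 2) (by omega)).mul
      ((((ih (k + 2 + 2) (by omega)).mul ((ih (k + 1) (by omega)).pow 2)).congr
          (e := -3 * ((k : ℤ) + 2) ^ 2 - 3) (by push_cast; ring) rfl).sub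
        (((ih k (by omega)).mul ((ih (k + 2 + 1) (by omega)).pow 2)).congr
          (by push_cast; ring) rfl))).div h₂ (by norm_num))
    rw [← h, mul_div_cancel_left₀ _ hψ2] at key
    refine key.congr (by push_cast; ring) ?_
    have hs := sign k
    rw [div_eq_iff (by norm_num)]
    push_cast
    have h1 : (-1 : K) ^ (2 * (k + 2) + 1) = -1 := by rw [pow_succ, pow_mul]; simp
    rw [h1]
    generalize hq : (-1 : K) ^ k = q at hs
    simp only [_root_.pow_add, hq]
    linear_combination (k + 2 : K) * ((k + 4) * (k + 1) ^ 2 * (q ^ 2 + 1)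
      - k * (k + 3) ^ 2 * (q ^ 2 + 1)) * hs
  · obtain ⟨k, rfl⟩ : ∃ k, m = k + 1 := ⟨m - 1, by omega⟩
    have h := hψodd (k + 1) (by omega)
    simp only [show k + 1 - 1 = k by omega] at h
    rw [h]
    refine ((((ih (k + 1 + 2) (by omega)).mul ((ih (k + 1) (by omega)).pow 3)).congr
        (by push_cast; ring) rfl).sub
      (((ih k (by omega)).mul ((ih (k + 1 + 1) (by omega)).pow 3)).congr
        (by push_cast; ring) rfl)).congr rfl ?_
    have hs := sign k
    push_cast
    have h1 : (-1 : K) ^ (2 * (k + 1) + 1 + 1) = 1 := by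
      rw [add_assoc, ← mul_add_one, pow_mul]; simp
    rw [h1]
    generalize hq : (-1 : K) ^ k = q at hs
    simp only [_root_.pow_add, hq]
    linear_combination ((k + 3 : K) * (k + 1) ^ 3 - k * (k + 2) ^ 3) * (q ^ 2 + 1) * hs

open HasLeadingTerm in
/-- **Leading term of division polynomials at infinity.**
Let `K` be a field of characteristic zero, `X Y : K((t))` Laurent series satisfying a Weierstrass
equation with `X = t⁻² + O(t⁻¹)` and `Y = -t⁻³ + O(t⁻²)`, and let `ψ n` denote the evaluation at
`(X, Y)` of the `n`-th division polynomial of the Weierstrass curve (characterized by the standard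
initial values and recurrences).  Then for every `n ≥ 1`, the Laurent series
`(-1)ⁿ·(X·ψₙ² - ψₙ₊₁·ψₙ₋₁)·(2ψₙ/ψ₂ₙ)·t^(-n²)` lies in `1 + t·K⟦t⟧`;
in particular its Laurent expansion has leading term `t⁰` with coefficient `1`. -/
theorem beta_n_w_coordinate_regular_at_infinity
    {K : Type*} [Field K] [CharZero K]
    (a₁ a₂ a₃ a₄ a₆ b₂ b₄ b₆ b₈ : K)
    (hb₂ : b₂ = a₁ ^ 2 + 4 * a₂)
    (hb₄ : b₄ = 2 * a₄ + a₁ * a₃)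
    (hb₆ : b₆ = a₃ ^ 2 + 4 * a₆)
    (hb₈ : b₈ = a₁ ^ 2 * a₆ + 4 * a₂ * a₆ - a₁ * a₃ * a₄ + a₂ * a₃ ^ 2 - a₄ ^ 2)
    (T X Y : LaurentSeries K)
    (hT : T = HahnSeries.single (1 : ℤ) (1 : K))
    (hW : Y ^ 2 + C a₁ * X * Y + C a₃ * Y
        = X ^ 3 + C a₂ * X ^ 2 + C a₄ * X + C a₆)
    (hX : ∃ f : PowerSeries K, T ^ 2 * X = 1 + T * (f : LaurentSeries K))
    (hY : ∃ g : PowerSeries K, T ^ 3 * Y = -1 + T * (g : LaurentSeries K))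
    (ψ : ℕ → LaurentSeries K)
    (hψ₀ : ψ 0 = 0)
    (hψ₁ : ψ 1 = 1)
    (hψ₂ : ψ 2 = 2 * Y + C a₁ * X + C a₃)
    (hψ₃ : ψ 3 = 3 * X ^ 4 + C b₂ * X ^ 3 + 3 * C b₄ * X ^ 2 + 3 * C b₆ * X + C b₈)
    (hψ₄ : ψ 4 = ψ 2 * (2 * X ^ 6 + C b₂ * X ^ 5 + 5 * C b₄ * X ^ 4 + 10 * C b₆ * X ^ 3
        + 10 * C b₈ * X ^ 2 + C (b₂ * b₈ - b₄ * b₆) * X + C (b₄ * b₈ - b₆ ^ 2)))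
    (hψodd : ∀ m : ℕ, 2 ≤ m →
        ψ (2 * m + 1) = ψ (m + 2) * ψ m ^ 3 - ψ (m - 1) * ψ (m + 1) ^ 3)
    (hψeven : ∀ m : ℕ, 2 ≤ m →
        ψ 2 * ψ (2 * m) = ψ m * (ψ (m + 2) * ψ (m - 1) ^ 2 - ψ (m - 2) * ψ (m + 1) ^ 2)) :
    ∀ n : ℕ, 1 ≤ n →
      ∃ f : PowerSeries K,
        (-1 : LaurentSeries K) ^ n * (X * ψ n ^ 2 - ψ (n + 1) * ψ (n - 1)) *
            (2 * ψ n / ψ (2 * n)) * T ^ (-(n : ℤ) ^ 2)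
          = 1 + T * (f : LaurentSeries K) := by
  have h0X : HasLeadingTerm X (-2) 1 := by
    obtain ⟨f, hf⟩ := hX
    exact of_single_pow_mul (k := 2) (u := f) (by rw [← hT, hf]; simp)
  have h0Y : HasLeadingTerm Y (-3) (-1) := by
    obtain ⟨g, hg⟩ := hY
    exact of_single_pow_mul (k := 3) (u := g) (by rw [← hT, hg]; simp)
  have lower {d : ℤ} (f : LaurentSeries K) (k : ℕ) (a : K) (hf : HasLeadingTerm f 0 a)
      (hk : d < -2 * k) : HasLeadingTerm (f * X ^ k) d 0 :=
    (hf.mul (h0X.pow k)).of_lt (by linarith)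
  have h₂ : HasLeadingTerm (ψ 2) (-3) (-2) := by
    rw [hψ₂]
    exact (((((natCast 2).mul h0Y).congr (by norm_num) rfl).add
      (((const a₁).mul h0X).of_lt (by norm_num))).add
      ((const a₃).of_lt (by norm_num))).congr rfl (by norm_num)
  have h₃ : HasLeadingTerm (ψ 3) (-8) 3 := by
    rw [hψ₃]
    exact ((((((natCast 3).mul (h0X.pow 4)).congr (by norm_num) rfl).add
      (lower _ 3 _ (const b₂) (by norm_num))).add
      (lower _ 2 _ (((natCast 3).mul (const b₄)).congr (by norm_num) rfl) (by norm_num))).add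
      ((((natCast 3).mul (const b₆)).mul h0X).of_lt (by norm_num))).add
      ((const b₈).of_lt (by norm_num)) |>.congr rfl (by norm_num)
  have h₄ : HasLeadingTerm (ψ 4) (-15) (-4) := by
    rw [hψ₄]
    have h := ((((((((natCast 2).mul (h0X.pow 6)).congr (e := -12) (by norm_num) rfl).add
      (lower _ 5 _ (const b₂) (by norm_num))).add
      (lower _ 4 _ (((natCast 5).mul (const b₄)).congr (by norm_num) rfl) (by norm_num))).add
      (lower _ 3 _ (((natCast 10).mul (const b₆)).congr (by norm_num) rfl) (by norm_num))).add
      (lower _ 2 _ (((natCast 10).mul (const b₈)).congr (by norm_num) rfl) (by norm_num))).add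
      (((const (b₂ * b₈ - b₄ * b₆)).mul h0X).of_lt (by norm_num))).add
      ((const (b₄ * b₈ - b₆ ^ 2)).of_lt (by norm_num))
    exact (h₂.mul h).congr (by norm_num) (by norm_num)
  have lead := hasLeadingTerm_of_divisionRecurrence ψ hψ₀ hψ₁ h₂ h₃ h₄ hψodd hψeven
  intro n hn
  obtain ⟨k, rfl⟩ : ∃ k, n = k + 1 := ⟨n - 1, by omega⟩
  have hn0 : ((k : K) + 1) ≠ 0 := by exact_mod_cast k.succ_ne_zero
  have sign : ((-1 : K) ^ k) ^ 2 = 1 := by rw [← pow_mul, mul_comm, pow_mul]; simp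
  have hsign : HasLeadingTerm ((-1 : LaurentSeries K) ^ (k + 1)) 0 ((-1) ^ (k + 1)) := by
    simpa only [map_pow, map_neg, map_one] using const ((-1 : K) ^ (k + 1))
  have hTpow : HasLeadingTerm (T ^ (-((k + 1 : ℕ) : ℤ) ^ 2)) (-((k + 1 : ℕ) : ℤ) ^ 2) 1 :=
by
    have h1 : HasLeadingTerm T 1 1 := ⟨1, by simp, by simp [hT]⟩
    have h2 := (h1.pow ((k + 1) ^ 2)).inv (by simp)
    rw [← zpow_natCast, ← zpow_neg] at h2
    simpa using h2
  have hφ : HasLeadingTerm (X * ψ (k + 1) ^ 2 - ψ (k + 1 + 1) * ψ k)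
      (-2 * ((k : ℤ) + 1) ^ 2) 1 := by
    refine (((h0X.mul ((lead (k + 1)).pow 2)).congr (by push_cast; ring) rfl).sub
      (((lead (k + 1 + 1)).mul (lead k)).congr (by push_cast; ring) rfl)).congr rfl ?_
    push_cast
    linear_combination ((k + 1 : K) ^ 2 - (k + 2) * k) * sign
  have hquot : HasLeadingTerm (2 * ψ (k + 1) / ψ (2 * (k + 1)))
      (3 * ((k : ℤ) + 1) ^ 2) ((-1) ^ (k + 1)) := by
    have hc : (-1 : K) ^ (2 * (k + 1) + 1) * ((2 * (k + 1) : ℕ) : K) = -2 * (k + 1) := by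
      rw [pow_succ, pow_mul]
      push_cast
      simp
    refine (((natCast 2).mul (lead (k + 1))).div ((lead (2 * (k + 1))).congr rfl hc)
      (by simpa using hn0)).congr (by push_cast; ring) ?_
    push_cast
    field_simp
    ring
  have h := ((hsign.mul hφ).mul hquot).mul hTpow
  obtain ⟨u, hu⟩ := (h.congr (e := 0) (c' := 1) (by push_cast; ring)
    (by linear_combination sign)).exists_eq_add
  exact ⟨u, by simpa [hT] using hu⟩
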